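/- Let d ≥ 2 be an integer and let s, r, δ ∈ ℝ satisfy δ > 1, d > 1 + δ − 2r, and s > d/2. Then there exists a constant C = C(r, d, δ, s) > 0 such that for every measurable g : ℝ^d → ℂ, ∫_{ℝ^d} |g(ξ)| dξ ≤ C (∫_{ℝ^d} ω_{s,r,δ}(ξ) |g(ξ)|² dξ)^{1/2}. -/

import Mathlib

open MeasureTheory

/-- The anisotropic weight `ω_{s,r,δ}`. -/
noncomputable def omegaW (d : ℕ) (hd : 0 < d) (s r δ : ℝ)
    (ξ : EuclideanSpace ℝ (Fin d)) : ENNReal :=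
  if ‖ξ‖ < 1 then ENNReal.ofReal ((|ξ ⟨0, hd⟩| ^ 2 + ‖ξ‖ ^ (2 * δ)) / ‖ξ‖ ^ (2 * r))
  else ENNReal.ofReal ((1 + ‖ξ‖ ^ 2) ^ s)

open Set

/-- Negative powers above `-1` of the absolute value are integrable on `(-1, 1)`. -/
lemma integrable_indicator_abs_rpow_neg {p : ℝ} (hp : p < 1) :
    Integrable ((Ioo (-1 : ℝ) 1).indicator fun t => |t| ^ (-p)) := by
  have h : IntervalIntegrable (fun t : ℝ => |t| ^ (-p)) volume 0 1 := by
    refine (intervalIntegral.intervalIntegrable_rpow' (r := -p) (by linarith)).congr ?_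
    intro t ht
    rw [uIoc_of_le zero_le_one] at ht
    simp only [abs_of_pos ht.1]
  have h' : IntervalIntegrable (fun t : ℝ => |t| ^ (-p)) volume (-1) 0 := by
    have := ((IntervalIntegrable.iff_comp_neg (a := 0) (b := 1)).1 h).symm
    simpa using this
  rw [integrable_indicator_iff measurableSet_Ioo]
  exact ((intervalIntegrable_iff_integrableOn_Ioc_of_le (by norm_num)).1 (h'.trans h)).mono_set
    Ioo_subset_Ioc_self

/-- The integrand bounding the inverse weight near the origin: a product of integrable functions
of one coordinate. -/
lemma integrable_prod_indicator_abs_rpow_neg {ι : Type*} [Fintype ι] {p : ι → ℝ}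
    (hp : ∀ i, p i < 1) :
    Integrable fun ξ : EuclideanSpace ℝ ι =>
      ∏ i, (Ioo (-1 : ℝ) 1).indicator (fun t => |t| ^ (-p i)) (ξ i) :=
  (PiLp.volume_preserving_ofLp ι).integrable_comp_of_integrable
    (Integrable.fintype_prod fun i => integrable_indicator_abs_rpow_neg (hp i))

lemma ae_forall_coord_ne_zero (ι : Type*) [Fintype ι] :
    ∀ᵐ ξ : EuclideanSpace ℝ ι, ∀ i, ξ i ≠ 0 := by
  rw [ae_all_iff]
  intro i
  exact (PiLp.volume_preserving_ofLp ι).quasiMeasurePreserving.ae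
    (Measure.ae_eval_ne (fun _ : ι => volume) i (0 : ℝ))

/-- Weighted arithmetic-geometric mean bound for the anisotropic denominator. -/
lemma rpow_mul_rpow_le_sq_add_rpow {x n δ η : ℝ} (hx : 0 ≤ x) (hn : 0 ≤ n) (hη0 : 0 ≤ η)
    (hη2 : η ≤ 2) : x ^ η * n ^ (δ * (2 - η)) ≤ x ^ 2 + n ^ (2 * δ) := by
  have h := Real.geom_mean_le_arith_mean2_weighted (w₁ := η / 2) (w₂ := 1 - η / 2)
    (p₁ := x ^ 2) (p₂ := n ^ (2 * δ)) (by linarith) (by linarith) (by positivity) (by positivity)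
    (by ring)
  have e₁ : (x ^ 2) ^ (η / 2) = x ^ η := by
    rw [← Real.rpow_natCast, ← Real.rpow_mul hx]
    congr 1
    push_cast
    ring
  have e₂ : (n ^ (2 * δ)) ^ (1 - η / 2) = n ^ (δ * (2 - η)) := by
    rw [← Real.rpow_mul hn]
    congr 1
    ring
  rw [e₁, e₂] at h
  have h₁ : 0 ≤ x ^ 2 := by positivity
  have h₂ : 0 ≤ n ^ (2 * δ) := by positivity
  nlinarith

lemma abs_coord_le_norm {ι : Type*} [Fintype ι] (ξ : EuclideanSpace ℝ ι) (i : ι) :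
    |ξ i| ≤ ‖ξ‖ := by
  simpa using PiLp.norm_apply_le ξ i

/-- In the unit ball the inverse anisotropic weight is bounded by a product of powers of the
coordinates, off the coordinate hyperplanes. -/
lemma div_anisotropic_le_prod {d : ℕ} (i₀ : Fin d) {r δ η κ : ℝ} (hη0 : 0 ≤ η) (hη2 : η ≤ 2)
    (hκ0 : 0 ≤ κ) (hκ : δ * (2 - η) - 2 * r ≤ κ * (d - 1 : ℕ))
    {ξ : EuclideanSpace ℝ (Fin d)} (hξ : ∀ i, ξ i ≠ 0) (hξ1 : ‖ξ‖ < 1) :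
    ‖ξ‖ ^ (2 * r) / (|ξ i₀| ^ 2 + ‖ξ‖ ^ (2 * δ)) ≤
      ∏ i, |ξ i| ^ (-(if i = i₀ then η else κ)) := by
  have hc : ∀ i, 0 < |ξ i| := fun i => abs_pos.2 (hξ i)
  have hn : 0 < ‖ξ‖ := (hc i₀).trans_le (abs_coord_le_norm ξ i₀)
  have hprod : ‖ξ‖ ^ (2 * r - δ * (2 - η)) ≤ ∏ i ∈ Finset.univ.erase i₀, |ξ i| ^ (-κ) := by
    calc ‖ξ‖ ^ (2 * r - δ * (2 - η)) ≤ ‖ξ‖ ^ (-κ * (d - 1 : ℕ)) :=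
          Real.rpow_le_rpow_of_exponent_ge hn hξ1.le (by linarith)
      _ = ∏ i ∈ Finset.univ.erase i₀, ‖ξ‖ ^ (-κ) := by
          rw [Finset.prod_const, Finset.card_erase_of_mem (Finset.mem_univ _), Finset.card_univ,
            Fintype.card_fin, Real.rpow_mul hn.le, Real.rpow_natCast]
      _ ≤ _ := Finset.prod_le_prod (fun i _ => by positivity) fun i _ =>
          Real.rpow_le_rpow_of_nonpos (hc i) (abs_coord_le_norm ξ i) (by linarith)
  have hfact : ∏ i, |ξ i| ^ (-(if i = i₀ then η else κ)) =
      |ξ i₀| ^ (-η) * ∏ i ∈ Finset.univ.erase i₀, |ξ i| ^ (-κ) := by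
    rw [← Finset.mul_prod_erase _ _ (Finset.mem_univ i₀), if_pos rfl]
    congr 1
    refine Finset.prod_congr rfl fun i hi => ?_
    rw [if_neg (Finset.ne_of_mem_erase hi)]
  have hden : 0 < |ξ i₀| ^ η * ‖ξ‖ ^ (δ * (2 - η)) :=
    mul_pos (Real.rpow_pos_of_pos (hc i₀) _) (Real.rpow_pos_of_pos hn _)
  calc ‖ξ‖ ^ (2 * r) / (|ξ i₀| ^ 2 + ‖ξ‖ ^ (2 * δ))
      ≤ ‖ξ‖ ^ (2 * r) / (|ξ i₀| ^ η * ‖ξ‖ ^ (δ * (2 - η))) := by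
        gcongr
        exact rpow_mul_rpow_le_sq_add_rpow (hc i₀).le hn.le hη0 hη2
    _ = |ξ i₀| ^ (-η) * ‖ξ‖ ^ (2 * r - δ * (2 - η)) := by
        rw [Real.rpow_sub hn, Real.rpow_neg (hc i₀).le]
        field_simp
    _ ≤ _ := by
        rw [hfact]
        gcongr

/-- Exponents below `1` for the product bound, available when `1 + δ - 2 r < d`. -/
lemma exists_product_exponents {d : ℕ} (hd : 2 ≤ d) {r δ : ℝ} (hδ : 0 < δ)
    (hdim : 1 + δ - 2 * r < d) :
    ∃ η κ : ℝ, 0 ≤ η ∧ η < 1 ∧ 0 ≤ κ ∧ κ < 1 ∧ δ * (2 - η) - 2 * r ≤ κ * (d - 1 : ℕ) := by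
  have hd' : ((d - 1 : ℕ) : ℝ) = d - 1 := by
    rw [Nat.cast_sub (by omega), Nat.cast_one]
  have hd2 : (2 : ℝ) ≤ d := by exact_mod_cast hd
  have hpos : (0 : ℝ) < d - 1 := by linarith
  have hlt : max 0 (2 - (d - 1 + 2 * r) / δ) < 1 := by
    refine max_lt one_pos ?_
    have : 1 < (d - 1 + 2 * r) / δ := by
      rw [lt_div_iff₀ hδ]
      linarith
    linarith
  obtain ⟨η, hη, hη1⟩ := exists_between hlt
  obtain ⟨hη0, hη2⟩ := max_lt_iff.1 hη
  have hgap : δ * (2 - η) < d - 1 + 2 * r := by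
    rw [← lt_div_iff₀' hδ]
    linarith
  refine ⟨η, max 0 (δ * (2 - η) - 2 * r) / (d - 1), hη0.le, hη1, by positivity, ?_, ?_⟩
  · rw [div_lt_one hpos]
    exact max_lt hpos (by linarith)
  · rw [hd', div_mul_cancel₀ _ hpos.ne']
    exact le_max_right _ _

lemma measurable_omegaW (d : ℕ) (hd : 0 < d) (s r δ : ℝ) : Measurable (omegaW d hd s r δ) := by
  unfold omegaW
  refine Measurable.ite (measurableSet_lt (by fun_prop) (by fun_prop)) ?_ ?_ <;> fun_prop

lemma omegaW_ne_top (d : ℕ) (hd : 0 < d) (s r δ : ℝ) (ξ : EuclideanSpace ℝ (Fin d)) :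
    omegaW d hd s r δ ξ ≠ ⊤ := by
  unfold omegaW
  split_ifs <;> exact ENNReal.ofReal_ne_top

lemma omegaW_ne_zero {d : ℕ} (hd : 0 < d) (s r δ : ℝ) {ξ : EuclideanSpace ℝ (Fin d)}
    (hξ : ξ ≠ 0) : omegaW d hd s r δ ξ ≠ 0 := by
  have := norm_pos_iff.2 hξ
  unfold omegaW
  split_ifs <;> exact (ENNReal.ofReal_pos.2 (by positivity)).ne'

/-- The inverse of the anisotropic weight is integrable. -/
lemma lintegral_inv_omegaW_lt_top {d : ℕ} (hd : 2 ≤ d) {s r δ : ℝ} (hδ : 0 < δ)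
    (hdim : 1 + δ - 2 * r < d) (hs : (d : ℝ) / 2 < s) (hd0 : 0 < d) :
    ∫⁻ ξ, (omegaW d hd0 s r δ ξ)⁻¹ < ⊤ := by
  obtain ⟨η, κ, hη0, hη1, hκ0, hκ1, hκ⟩ := exists_product_exponents hd hδ hdim
  set p : Fin d → ℝ := fun i => if i = ⟨0, hd0⟩ then η else κ with hp
  have hp1 : ∀ i, p i < 1 := fun i => by
    simp only [hp]
    split_ifs <;> assumption
  have hin := integrable_prod_indicator_abs_rpow_neg hp1
  have hout : Integrable fun ξ : EuclideanSpace ℝ (Fin d) => (1 + ‖ξ‖ ^ 2) ^ (-(2 * s) / 2) :=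
    integrable_rpow_neg_one_add_norm_sq (by rw [finrank_euclideanSpace_fin]; linarith)
  refine lt_of_le_of_lt (lintegral_mono_ae ?_) (hin.add hout).lintegral_lt_top
  filter_upwards [ae_forall_coord_ne_zero (Fin d)] with ξ hξ
  have hn : 0 < ‖ξ‖ := (abs_pos.2 (hξ ⟨0, hd0⟩)).trans_le (abs_coord_le_norm ξ _)
  have hin0 : 0 ≤ ∏ i, (Ioo (-1 : ℝ) 1).indicator (fun t => |t| ^ (-p i)) (ξ i) :=
    Finset.prod_nonneg fun i _ => indicator_nonneg (fun t _ => by positivity) _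
  have hout0 : 0 ≤ (1 + ‖ξ‖ ^ 2) ^ (-(2 * s) / 2) := by positivity
  simp only [Pi.add_apply]
  unfold omegaW
  split_ifs with h
  · rw [← ENNReal.ofReal_inv_of_pos (by positivity), inv_div]
    refine ENNReal.ofReal_le_ofReal (le_add_of_le_of_nonneg ?_ hout0)
    refine (div_anisotropic_le_prod ⟨0, hd0⟩ hη0 (by linarith) hκ0 hκ hξ h).trans_eq ?_
    refine Finset.prod_congr rfl fun i _ => ?_
    rw [indicator_of_mem]
    exact abs_lt.1 ((abs_coord_le_norm ξ i).trans_lt h)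
  · rw [← ENNReal.ofReal_inv_of_pos (by positivity), ← Real.rpow_neg (by positivity)]
    refine ENNReal.ofReal_le_ofReal (le_add_of_nonneg_of_le hin0 (le_of_eq ?_))
    congr 1
    ring

/-- Cauchy-Schwarz inequality with a weight and its inverse. -/
lemma lintegral_le_lintegral_inv_mul_lintegral_weight {α : Type*} [MeasurableSpace α]
    {μ : Measure α} {w f : α → ENNReal} (hw : AEMeasurable w μ) (hf : AEMeasurable f μ)
    (hw0 : ∀ᵐ x ∂μ, w x ≠ 0) (hwtop : ∀ᵐ x ∂μ, w x ≠ ⊤) :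
    ∫⁻ x, f x ∂μ ≤
      (∫⁻ x, (w x)⁻¹ ∂μ) ^ (1 / 2 : ℝ) * (∫⁻ x, w x * f x ^ 2 ∂μ) ^ (1 / 2 : ℝ) := by
  have hsq : ∀ a : ENNReal, (a ^ (1 / 2 : ℝ)) ^ (2 : ℝ) = a := fun a => by
    rw [← ENNReal.rpow_mul]
    norm_num
  have hcs := ENNReal.lintegral_mul_le_Lp_mul_Lq μ Real.HolderConjugate.two_two
    (f := fun x => (w x)⁻¹ ^ (1 / 2 : ℝ)) (g := fun x => w x ^ (1 / 2 : ℝ) * f x)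
    (hw.inv.pow_const _) ((hw.pow_const _).mul hf)
  simp only [Pi.mul_apply, ENNReal.mul_rpow_of_nonneg _ _ zero_le_two, hsq,
    ENNReal.rpow_two] at hcs
  refine le_trans (lintegral_mono_ae ?_) hcs
  filter_upwards [hw0, hwtop] with x h0 htop
  rw [← mul_assoc, ← ENNReal.mul_rpow_of_nonneg _ _ (by norm_num), ENNReal.inv_mul_cancel h0 htop,
    ENNReal.one_rpow, one_mul]

theorem stmt3 (d : ℕ) (hd : 2 ≤ d) (s r δ : ℝ) (hδ : 1 < δ)
    (hdim : 1 + δ - 2 * r < (d : ℝ)) (hs : (d : ℝ) / 2 < s) :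
    ∃ C : ℝ, 0 < C ∧ ∀ g : EuclideanSpace ℝ (Fin d) → ℂ, Measurable g →
      (∫⁻ ξ, (‖g ξ‖₊ : ENNReal)) ≤
      ENNReal.ofReal C *
        (∫⁻ ξ, omegaW d (by omega) s r δ ξ * (‖g ξ‖₊ : ENNReal) ^ 2) ^ (1/2 : ℝ) := by
  have hd0 : 0 < d := by omega
  set A := (∫⁻ ξ, (omegaW d hd0 s r δ ξ)⁻¹) ^ (1 / 2 : ℝ) with hA
  have hAtop : A ≠ ⊤ := ENNReal.rpow_ne_top_of_nonneg (by norm_num)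
    (lintegral_inv_omegaW_lt_top hd (by linarith) hdim hs hd0).ne
  refine ⟨A.toReal + 1, by positivity, fun g hg => ?_⟩
  refine (lintegral_le_lintegral_inv_mul_lintegral_weight
    (measurable_omegaW d hd0 s r δ).aemeasurable (by fun_prop) ?_
    (ae_of_all _ (omegaW_ne_top d hd0 s r δ))).trans ?_
  · filter_upwards [ae_forall_coord_ne_zero (Fin d)] with ξ hξ
    refine omegaW_ne_zero hd0 s r δ fun h => hξ ⟨0, hd0⟩ ?_
    simp [h]
  · gcongr
    rw [← hA, ← ENNReal.ofReal_toReal hAtop]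
    exact ENNReal.ofReal_le_ofReal (by simp)
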